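/- Let γ ∈ [−3, 1]. There exists a constant C > 0, depending only on γ, such that for all Schwartz functions f, g, h : ℝ³ → ℝ, the Landau collision operator satisfies both | ∫_{ℝ³} Q(f, g)(v) h(v) dv | ≤ C · ‖f‖_{L²_5} · ‖g‖_{L²(ℝ³)} · ‖h‖_{H²_5} and | ∫_{ℝ³} Q(f, g)(v) h(v) dv | ≤ C · ‖f‖_{L²_5} · ‖g‖_{L²_{10}} · ‖h‖_{H²_{−5}}. -/

import Mathlib

open MeasureTheory Classical

noncomputable section

/-- Japanese bracket `⟨v⟩ = (1 + |v|²)^(1/2)`. -/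
def jb (v : EuclideanSpace ℝ (Fin 3)) : ℝ := (1 + ‖v‖ ^ 2) ^ ((1 : ℝ) / 2)

/-- Partial derivative in the `i`-th coordinate direction. -/
def pd (i : Fin 3) (g : EuclideanSpace ℝ (Fin 3) → ℝ) : EuclideanSpace ℝ (Fin 3) → ℝ :=
  fun v => fderiv ℝ g v (EuclideanSpace.single i 1)

/-- Iterated partial derivative `∂^β` for a multi-index `β = (β₀, β₁, β₂)`. -/
def pdM (β : ℕ × ℕ × ℕ) (g : EuclideanSpace ℝ (Fin 3) → ℝ) : EuclideanSpace ℝ (Fin 3) → ℝ :=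
  (pd 0)^[β.1] ((pd 1)^[β.2.1] ((pd 2)^[β.2.2] g))

/-- Multi-indices `β` of order `|β| ≤ n`. -/
def multiIdx (n : ℕ) : Finset (ℕ × ℕ × ℕ) :=
  (Finset.range (n + 1) ×ˢ Finset.range (n + 1) ×ˢ Finset.range (n + 1)).filter
    (fun β => β.1 + β.2.1 + β.2.2 ≤ n)

/-- The Landau kernel matrix `φ^{ij}(u) = |u|^(γ+2) (δ_{ij} - uᵢuⱼ/|u|²)` (set to `0` at `u = 0`). -/
def phiK (γ : ℝ) (i j : Fin 3) (u : EuclideanSpace ℝ (Fin 3)) : ℝ :=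
  if u = 0 then 0 else ‖u‖ ^ (γ + 2) * ((if i = j then 1 else 0) - u i * u j / ‖u‖ ^ 2)

/-- The Landau collision operator
`Q(f,g)(v) = ∑_{i,j} ∂_{v_i} ∫ φ^{ij}(v-v_*) (f(v_*) ∂_{v_j} g(v) - g(v) (∂_j f)(v_*)) dv_*`. -/
def landauQ (γ : ℝ) (f g : EuclideanSpace ℝ (Fin 3) → ℝ) (v : EuclideanSpace ℝ (Fin 3)) : ℝ :=
  ∑ i : Fin 3, ∑ j : Fin 3,
    pd i (fun v' => ∫ vs, phiK γ i j (v' - vs) * (f vs * pd j g v' - g v' * pd j f vs)) v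

/-- Weighted `L²` norm `‖⟨v⟩^l f‖_{L²(ℝ³)}`. -/
def nrm2 (l : ℝ) (f : EuclideanSpace ℝ (Fin 3) → ℝ) : ℝ :=
  Real.sqrt (∫ v, (jb v ^ l * f v) ^ 2)

/-- Weighted second-order Sobolev norm `‖h‖_{H²_l} = ∑_{|β| ≤ 2} ‖⟨v⟩^l ∂^β h‖_{L²}`. -/
def H2w (l : ℝ) (h : EuclideanSpace ℝ (Fin 3) → ℝ) : ℝ :=
  ∑ β ∈ multiIdx 2, nrm2 l (pdM β h)

open SchwartzMap LineDeriv Filter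
open scoped ENNReal Topology

local notation "E3" => EuclideanSpace ℝ (Fin 3)

/-! ### Elementary facts about Schwartz functions and brackets -/

/-- The `i`-th partial derivative as an operation on Schwartz functions. -/
def schwartzPd (i : Fin 3) (F : SchwartzMap E3 ℝ) : SchwartzMap E3 ℝ :=
  lineDerivOp (EuclideanSpace.single i (1 : ℝ)) F

lemma coe_schwartzPd (i : Fin 3) (F : SchwartzMap E3 ℝ) : ⇑(schwartzPd i F) = pd i F := by
  ext v
  exact SchwartzMap.lineDerivOp_apply_eq_fderiv _ F v

lemma peetre (u v : E3) : 1 + ‖u‖ ^ 2 ≤ 2 * ((1 + ‖v‖ ^ 2) * (1 + ‖v - u‖ ^ 2)) := by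
  have h : ‖u‖ ≤ ‖v‖ + ‖v - u‖ := by
    calc ‖u‖ = ‖v - (v - u)‖ := by simp
      _ ≤ _ := norm_sub_le _ _
  have h2 : ‖u‖ ^ 2 ≤ (‖v‖ + ‖v - u‖) ^ 2 := by gcongr
  nlinarith [sq_nonneg (‖v‖ - ‖v - u‖), mul_nonneg (sq_nonneg ‖v‖) (sq_nonneg ‖v - u‖)]

lemma schwartz_decay {G : Type*} [NormedAddCommGroup G] [NormedSpace ℝ G] (F : SchwartzMap E3 G)
    (N : ℕ) : ∃ C, 0 ≤ C ∧ ∀ v, ‖F v‖ * (1 + ‖v‖ ^ 2) ^ N ≤ C := by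
  obtain ⟨C, hC⟩ : ∃ C, ∀ v, (1 + ‖v‖) ^ (2 * N) * ‖iteratedFDeriv ℝ 0 F v‖ ≤ C :=
    ⟨_, fun v => SchwartzMap.one_add_le_sup_seminorm_apply (𝕜 := ℝ) (m := (2 * N, 0)) le_rfl le_rfl
      F v⟩
  have key : ∀ v, ‖F v‖ * (1 + ‖v‖ ^ 2) ^ N ≤ C := by
    intro v
    refine le_trans ?_ (hC v)
    rw [norm_iteratedFDeriv_zero, mul_comm, pow_mul]
    gcongr
    nlinarith [norm_nonneg v]
  exact ⟨C, le_trans (by positivity) (key 0), key⟩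

/-- An integrable radial weight on `ℝ³` with a `|u|⁻²` singularity. -/
def rho (u : E3) : ℝ := (‖u‖ ^ 2)⁻¹ * (1 + ‖u‖ ^ 2)⁻¹

lemma rho_nonneg (u : E3) : 0 ≤ rho u := by unfold rho; positivity

lemma integrable_rho : Integrable rho := by
  have h := (integrable_fun_norm_addHaar (E := E3) volume
    (f := fun r : ℝ => (r ^ 2)⁻¹ * (1 + r ^ 2)⁻¹)).2 ?_
  · exact h
  · simp only [finrank_euclideanSpace, Fintype.card_fin, smul_eq_mul]
    refine (integrable_inv_one_add_sq.integrableOn (s := Set.Ioi 0)).congr_fun ?_ measurableSet_Ioi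
    intro r hr
    have hr : (0 : ℝ) < r := hr
    simp only [Nat.reduceSub]
    field_simp

/-! ### Functions of polynomial growth and integration by parts -/

/-- Differentiable functions which, with their first derivatives, have polynomial growth. -/
structure PolyGrowth (a : E3 → ℝ) : Prop where
  diff : Differentiable ℝ a
  bound : ∃ C, ∀ v, |a v| ≤ C * (1 + ‖v‖ ^ 2) ^ 4
  bound_pd : ∃ C, ∀ i v, |pd i a v| ≤ C * (1 + ‖v‖ ^ 2) ^ 4

lemma measurable_pd (i : Fin 3) (a : E3 → ℝ) : Measurable (pd i a) :=
  measurable_fderiv_apply_const ℝ a _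

lemma integrable_of_growth_mul_schwartz {a : E3 → ℝ} (ha : AEStronglyMeasurable a volume)
    (hb : ∃ C, ∀ v, |a v| ≤ C * (1 + ‖v‖ ^ 2) ^ 4) (q : SchwartzMap E3 ℝ) :
    Integrable (fun v => a v * q v) := by
  obtain ⟨C, hC⟩ := hb
  obtain ⟨K, hK0, hK⟩ := schwartz_decay q 6
  have hC0 : 0 ≤ C := by
    have := (abs_nonneg _).trans (hC 0)
    simpa using this
  have hint : Integrable (fun v : E3 => (1 + ‖v‖ ^ 2) ^ (-(4 : ℝ) / 2)) :=
    integrable_rpow_neg_one_add_norm_sq (by norm_num)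
  refine (hint.const_mul (C * K)).mono' (ha.mul q.continuous.aestronglyMeasurable) ?_
  refine .of_forall fun v => ?_
  have hw : 0 < 1 + ‖v‖ ^ 2 := by positivity
  have e : (1 + ‖v‖ ^ 2) ^ (-(4 : ℝ) / 2) = ((1 + ‖v‖ ^ 2) ^ 2)⁻¹ := by
    rw [show (-(4 : ℝ) / 2) = -((2 : ℕ) : ℝ) by norm_num, Real.rpow_neg hw.le, Real.rpow_natCast]
  rw [e, ← div_eq_mul_inv, le_div_iff₀ (by positivity), norm_mul, Real.norm_eq_abs]
  calc |a v| * ‖q v‖ * (1 + ‖v‖ ^ 2) ^ 2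
      ≤ C * (1 + ‖v‖ ^ 2) ^ 4 * ‖q v‖ * (1 + ‖v‖ ^ 2) ^ 2 := by gcongr; exact hC v
    _ = C * (‖q v‖ * (1 + ‖v‖ ^ 2) ^ 6) := by ring
    _ ≤ C * K := by gcongr; exact hK v

namespace PolyGrowth

variable {a : EuclideanSpace ℝ (Fin 3) → ℝ}

lemma integrable_mul (ha : PolyGrowth a) (q : SchwartzMap E3 ℝ) :
    Integrable (fun v => a v * q v) :=
  integrable_of_growth_mul_schwartz ha.diff.continuous.aestronglyMeasurable ha.bound q

lemma integrable_pd_mul (ha : PolyGrowth a) (i : Fin 3) (q : SchwartzMap E3 ℝ) :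
    Integrable (fun v => pd i a v * q v) :=
  integrable_of_growth_mul_schwartz (measurable_pd i a).aestronglyMeasurable
    (ha.bound_pd.imp fun _ h => h i) q

lemma integral_mul_pd (ha : PolyGrowth a) (i : Fin 3) (q : SchwartzMap E3 ℝ) :
    ∫ v, a v * pd i q v = -∫ v, pd i a v * q v := by
  refine integral_mul_fderiv_eq_neg_fderiv_mul_of_integrable (ha.integrable_pd_mul i q) ?_
    (ha.integrable_mul q) (fun x _ => ha.diff x) (fun x _ => q.differentiableAt)
  have := ha.integrable_mul (schwartzPd i q)
  rwa [coe_schwartzPd] at this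

lemma pd_mul (ha : PolyGrowth a) (p : SchwartzMap E3 ℝ) (i : Fin 3) (v : E3) :
    pd i (fun v => a v * p v) v = pd i a v * p v + a v * pd i p v := by
  unfold pd
  rw [((ha.diff v).hasFDerivAt.fun_mul (p.hasFDerivAt v)).fderiv]
  simp
  ring

lemma mul_schwartz (ha : PolyGrowth a) (p : SchwartzMap E3 ℝ) :
    PolyGrowth (fun v => a v * p v) := by
  obtain ⟨A, hA⟩ := ha.bound
  obtain ⟨B, hB⟩ := ha.bound_pd
  obtain ⟨P, hP0, hP⟩ := schwartz_decay p 0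
  have hd : ∀ i, ∃ Q, 0 ≤ Q ∧ ∀ v, |pd i p v| ≤ Q := fun i => by
    obtain ⟨Q, hQ0, hQ⟩ := schwartz_decay (schwartzPd i p) 0
    exact ⟨Q, hQ0, fun v => by simpa [coe_schwartzPd] using hQ v⟩
  choose Q hQ0 hQ using hd
  simp only [pow_zero, mul_one, Real.norm_eq_abs] at hP
  have hA' : ∀ v, 0 ≤ A * (1 + ‖v‖ ^ 2) ^ 4 := fun v => (abs_nonneg _).trans (hA v)
  have hB' : ∀ v, 0 ≤ B * (1 + ‖v‖ ^ 2) ^ 4 := fun v => (abs_nonneg _).trans (hB 0 v)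
  refine ⟨ha.diff.mul p.differentiable, ⟨A * P, fun v => ?_⟩, ⟨B * P + A * ∑ i, Q i, fun i v => ?_⟩⟩
  · rw [abs_mul]
    calc |a v| * |p v| ≤ A * (1 + ‖v‖ ^ 2) ^ 4 * P :=
          mul_le_mul (hA v) (hP v) (abs_nonneg _) (hA' v)
      _ = _ := by ring
  · rw [ha.pd_mul]
    have hQi : Q i ≤ ∑ i, Q i := Finset.single_le_sum (fun j _ => hQ0 j) (Finset.mem_univ i)
    calc |pd i a v * p v + a v * pd i p v|
        ≤ |pd i a v| * |p v| + |a v| * |pd i p v| := by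
          rw [← abs_mul, ← abs_mul]; exact abs_add_le _ _
      _ ≤ B * (1 + ‖v‖ ^ 2) ^ 4 * P + A * (1 + ‖v‖ ^ 2) ^ 4 * ∑ i, Q i :=
          add_le_add (mul_le_mul (hB i v) (hP v) (abs_nonneg _) (hB' v))
            (mul_le_mul (hA v) ((hQ i v).trans hQi) (abs_nonneg _) (hA' v))
      _ = _ := by ring

lemma pd_comp_sub_left (ha : PolyGrowth a) (c : E3) (i : Fin 3) (v : E3) :
    pd i (fun v => a (c - v)) v = -pd i a (c - v) := by
  unfold pd
  have h : HasFDerivAt (fun v : E3 => c - v) (-ContinuousLinearMap.id ℝ E3) v :=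
    (hasFDerivAt_id v).const_sub c
  have := ((ha.diff (c - v)).hasFDerivAt.comp v h).fderiv
  simp only [Function.comp_def] at this
  rw [this]
  simp

lemma comp_sub_left (ha : PolyGrowth a) (c : E3) : PolyGrowth (fun v => a (c - v)) := by
  have key : ∀ {φ : E3 → ℝ} {C : ℝ}, (∀ v, |φ v| ≤ C * (1 + ‖v‖ ^ 2) ^ 4) → ∀ v,
      |φ (c - v)| ≤ C * 16 * (1 + ‖c‖ ^ 2) ^ 4 * (1 + ‖v‖ ^ 2) ^ 4 := by
    intro φ C h v
    have hC0 : 0 ≤ C := by simpa using (abs_nonneg _).trans (h 0)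
    have hp := peetre (c - v) c
    rw [sub_sub_cancel] at hp
    calc |φ (c - v)| ≤ C * (1 + ‖c - v‖ ^ 2) ^ 4 := h _
      _ ≤ C * (2 * ((1 + ‖c‖ ^ 2) * (1 + ‖v‖ ^ 2))) ^ 4 := by gcongr
      _ = _ := by ring
  obtain ⟨A, hA⟩ := ha.bound
  obtain ⟨B, hB⟩ := ha.bound_pd
  refine ⟨ha.diff.comp (differentiable_const c |>.sub differentiable_id), ⟨_, key hA⟩,
    ⟨B * 16 * (1 + ‖c‖ ^ 2) ^ 4, fun i v => ?_⟩⟩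
  rw [ha.pd_comp_sub_left, abs_neg]
  exact key (hB i) v

/-- Integration by parts against a product of Schwartz functions. -/
lemma integral_mul_mul_pd (ha : PolyGrowth a) (p q : SchwartzMap E3 ℝ) (i : Fin 3) :
    ∫ v, a v * p v * pd i q v = -∫ v, (pd i a v * p v + a v * pd i p v) * q v := by
  rw [(ha.mul_schwartz p).integral_mul_pd i q]
  simp_rw [ha.pd_mul]

end PolyGrowth

/-! ### Convolution with singular kernels -/

/-- Kernels on `ℝ³` with at most a `|u|⁻²` singularity and polynomial growth. -/
structure SingularKernel (k : E3 → ℝ) : Prop where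
  meas : Measurable k
  bound : ∃ C, 0 ≤ C ∧ ∀ u, |k u| ≤ C * (rho u * (1 + ‖u‖ ^ 2) ^ 4)

/-- Convolution of a kernel with a function. -/
def kconv (k F : E3 → ℝ) (v : E3) : ℝ := ∫ u, k u * F (v - u)

lemma mul_comp_sub_le {G : Type*} [NormedAddCommGroup G] {k : E3 → ℝ} {F : E3 → G} {C K : ℝ}
    (hk : ∀ u, |k u| ≤ C * (rho u * (1 + ‖u‖ ^ 2) ^ 4))
    (hC : 0 ≤ C) (hF : ∀ v, ‖F v‖ * (1 + ‖v‖ ^ 2) ^ 4 ≤ K) (u v : E3) :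
    |k u| * ‖F (v - u)‖ ≤ 16 * C * K * (1 + ‖v‖ ^ 2) ^ 4 * rho u := by
  have hr := rho_nonneg u
  calc |k u| * ‖F (v - u)‖ ≤ C * (rho u * (1 + ‖u‖ ^ 2) ^ 4) * ‖F (v - u)‖ := by gcongr; exact hk u
    _ ≤ C * (rho u * (2 * ((1 + ‖v‖ ^ 2) * (1 + ‖v - u‖ ^ 2))) ^ 4) * ‖F (v - u)‖ := by
        gcongr; exact peetre u v
    _ = 16 * C * (1 + ‖v‖ ^ 2) ^ 4 * rho u * (‖F (v - u)‖ * (1 + ‖v - u‖ ^ 2) ^ 4) := by ring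
    _ ≤ 16 * C * (1 + ‖v‖ ^ 2) ^ 4 * rho u * K := by gcongr; exact hF _
    _ = _ := by ring

namespace SingularKernel

variable {k : EuclideanSpace ℝ (Fin 3) → ℝ}

lemma integrable (hk : SingularKernel k) (F : SchwartzMap E3 ℝ) (v : E3) :
    Integrable (fun u => k u * F (v - u)) := by
  obtain ⟨C, hC0, hC⟩ := hk.bound
  obtain ⟨K, -, hK⟩ := schwartz_decay F 4
  refine (integrable_rho.const_mul (16 * C * K * (1 + ‖v‖ ^ 2) ^ 4)).mono'
    (hk.meas.aestronglyMeasurable.mul (by fun_prop)) (.of_forall fun u => ?_)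
  rw [norm_mul]
  exact mul_comp_sub_le hC hC0 hK u v

lemma growth (hk : SingularKernel k) (F : SchwartzMap E3 ℝ) :
    ∃ C, ∀ v, |kconv k F v| ≤ C * (1 + ‖v‖ ^ 2) ^ 4 := by
  obtain ⟨C, hC0, hC⟩ := hk.bound
  obtain ⟨K, -, hK⟩ := schwartz_decay F 4
  refine ⟨16 * C * K * ∫ u, rho u, fun v => ?_⟩
  calc |kconv k F v| ≤ ∫ u, 16 * C * K * (1 + ‖v‖ ^ 2) ^ 4 * rho u := by
        refine norm_integral_le_of_norm_le (f := fun u => k u * F (v - u))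
          (integrable_rho.const_mul _) (.of_forall fun u => ?_)
        rw [norm_mul]
        exact mul_comp_sub_le hC hC0 hK u v
    _ = _ := by rw [integral_const_mul]; ring

lemma hasFDerivAt (hk : SingularKernel k) (F : SchwartzMap E3 ℝ) (v : E3) :
    HasFDerivAt (kconv k F) (∫ u, k u • fderiv ℝ F (v - u)) v := by
  obtain ⟨C, hC0, hC⟩ := hk.bound
  obtain ⟨K, hK0, hK⟩ := schwartz_decay (SchwartzMap.fderivCLM ℝ E3 ℝ F) 4
  simp only [SchwartzMap.fderivCLM_apply] at hK
  have hcont : Continuous (fderiv ℝ F) := (F.smooth 1).continuous_fderiv (by norm_num)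
  refine hasFDerivAt_integral_of_dominated_of_fderiv_le
    (F := fun v u => k u * F (v - u)) (F' := fun v u => k u • fderiv ℝ F (v - u))
    (bound := fun u => 16 * C * K * (1 + (‖v‖ + 1) ^ 2) ^ 4 * rho u)
    (Metric.ball_mem_nhds v one_pos) (.of_forall fun x => (hk.integrable F x).1)
    (hk.integrable F v) ?_ ?_ (integrable_rho.const_mul _) ?_
  · exact hk.meas.aestronglyMeasurable.smul
      (hcont.comp (continuous_const.sub continuous_id)).aestronglyMeasurable
  · refine .of_forall fun u x hx => ?_
    have hx' : ‖x‖ ≤ ‖v‖ + 1 := by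
      have h1 : ‖x - v‖ < 1 := by simpa [dist_eq_norm] using hx
      have h2 := norm_add_le (x - v) v
      rw [sub_add_cancel] at h2
      linarith
    have hr := rho_nonneg u
    rw [norm_smul]
    refine (mul_comp_sub_le hC hC0 hK u x).trans ?_
    gcongr
  · refine .of_forall fun u x _ => ?_
    have h1 : HasFDerivAt (fun x : E3 => x - u) (ContinuousLinearMap.id ℝ E3) x :=
      (hasFDerivAt_id x).sub_const u
    have h2 := (F.hasFDerivAt (x - u)).comp x h1
    exact h2.const_mul (k u)

lemma integrable_smul_fderiv (hk : SingularKernel k) (F : SchwartzMap E3 ℝ) (v : E3) :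
    Integrable (fun u => k u • fderiv ℝ F (v - u)) := by
  obtain ⟨C, hC0, hC⟩ := hk.bound
  obtain ⟨K, hK0, hK⟩ := schwartz_decay (SchwartzMap.fderivCLM ℝ E3 ℝ F) 4
  simp only [SchwartzMap.fderivCLM_apply] at hK
  have hcont : Continuous (fderiv ℝ F) := (F.smooth 1).continuous_fderiv (by norm_num)
  refine (integrable_rho.const_mul (16 * C * K * (1 + ‖v‖ ^ 2) ^ 4)).mono'
    (hk.meas.aestronglyMeasurable.smul
      (hcont.comp (continuous_const.sub continuous_id)).aestronglyMeasurable)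
    (.of_forall fun u => ?_)
  rw [norm_smul]
  exact mul_comp_sub_le hC hC0 hK u v

lemma pd_kconv (hk : SingularKernel k) (F : SchwartzMap E3 ℝ) (i : Fin 3) :
    pd i (kconv k F) = kconv k (schwartzPd i F) := by
  ext v
  rw [coe_schwartzPd]
  unfold pd
  rw [(hk.hasFDerivAt F v).fderiv,
    ContinuousLinearMap.integral_apply (hk.integrable_smul_fderiv F v)]
  rfl

lemma polyGrowth (hk : SingularKernel k) (F : SchwartzMap E3 ℝ) : PolyGrowth (kconv k F) := by
  refine ⟨fun v => (hk.hasFDerivAt F v).differentiableAt, hk.growth F, ?_⟩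
  choose C hC using fun i => hk.growth (schwartzPd i F)
  refine ⟨∑ i, C i, fun i v => ?_⟩
  rw [hk.pd_kconv]
  refine (hC i v).trans ?_
  have hC0 : ∀ i, 0 ≤ C i := fun i => by simpa using (abs_nonneg _).trans (hC i 0)
  gcongr
  exact Finset.single_le_sum (fun j _ => hC0 j) (Finset.mem_univ i)

end SingularKernel

lemma kconv_eq_integral_sub (k F : E3 → ℝ) (v : E3) :
    kconv k F v = ∫ w, k (v - w) * F w := by
  unfold kconv
  rw [← integral_sub_left_eq_self _ volume v]
  simp

lemma tendsto_kconv {k : ℕ → E3 → ℝ} {k₀ : E3 → ℝ} {C : ℝ} (hC0 : 0 ≤ C)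
    (hmeas : ∀ n, Measurable (k n))
    (hk : ∀ n u, |k n u| ≤ C * (rho u * (1 + ‖u‖ ^ 2) ^ 4))
    (hlim : ∀ u, Tendsto (fun n => k n u) atTop (𝓝 (k₀ u))) (F : SchwartzMap E3 ℝ) (v : E3) :
    Tendsto (fun n => kconv (k n) F v) atTop (𝓝 (kconv k₀ F v)) := by
  obtain ⟨K, -, hK⟩ := schwartz_decay F 4
  refine tendsto_integral_of_dominated_convergence
    (fun u => 16 * C * K * (1 + ‖v‖ ^ 2) ^ 4 * rho u)
    (fun n => (hmeas n).aestronglyMeasurable.mul (by fun_prop)) (integrable_rho.const_mul _)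
    (fun n => .of_forall fun u => ?_) (.of_forall fun u => (hlim u).mul_const _)
  rw [norm_mul]
  exact mul_comp_sub_le (hk n) hC0 hK u v

/-! ### The regularised Landau kernel and its divergence -/

/-- The Landau kernel with `|u|²` replaced by `|u|² + ε` in the power. -/
def phiReg (γ ε : ℝ) (i j : Fin 3) (u : E3) : ℝ :=
  (‖u‖ ^ 2 + ε) ^ (γ / 2) * (‖u‖ ^ 2 * (if i = j then 1 else 0) - u i * u j)

/-- The divergence of the regularised Landau kernel. -/
def divReg (γ ε : ℝ) (i : Fin 3) (u : E3) : ℝ := -2 * (‖u‖ ^ 2 + ε) ^ (γ / 2) * u i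

lemma phiK_eq_phiReg (γ : ℝ) (i j : Fin 3) : phiK γ i j = phiReg γ 0 i j := by
  ext u
  unfold phiK phiReg
  by_cases hu : u = 0
  · simp [hu]
  · have hn : 0 < ‖u‖ := norm_pos_iff.2 hu
    have e : (‖u‖ ^ 2 + 0) ^ (γ / 2) = ‖u‖ ^ γ := by
      rw [add_zero, ← Real.rpow_natCast, ← Real.rpow_mul hn.le]
      congr 1
      push_cast
      ring
    rw [if_neg hu, e, Real.rpow_add hn, Real.rpow_ofNat]
    field_simp

lemma abs_apply_le_norm (u : E3) (i : Fin 3) : |u i| ≤ ‖u‖ := PiLp.norm_apply_le u i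

lemma abs_phi_factor_le (u : E3) (i j : Fin 3) :
    |‖u‖ ^ 2 * (if i = j then 1 else 0) - u i * u j| ≤ 2 * ‖u‖ ^ 2 := by
  have h1 : |u i * u j| ≤ ‖u‖ ^ 2 := by
    rw [abs_mul, sq]
    exact mul_le_mul (abs_apply_le_norm u i) (abs_apply_le_norm u j) (abs_nonneg _) (norm_nonneg _)
  have h2 : |‖u‖ ^ 2 * (if i = j then (1 : ℝ) else 0)| ≤ ‖u‖ ^ 2 := by
    split_ifs <;> simp
  exact (abs_sub _ _).trans (by linarith)

lemma rpow_half_le {γ s : ℝ} (hγ : γ ∈ Set.Icc (-3 : ℝ) 1) (hs : 0 < s) :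
    s ^ (γ / 2) ≤ s ^ (-(3 : ℝ) / 2) + s ^ ((1 : ℝ) / 2) := by
  obtain ⟨h1, h2⟩ := hγ
  rcases le_total s 1 with h | h
  · have := Real.rpow_le_rpow_of_exponent_ge hs h (show -(3 : ℝ) / 2 ≤ γ / 2 by linarith)
    have := Real.rpow_nonneg hs.le ((1 : ℝ) / 2)
    linarith
  · have := Real.rpow_le_rpow_of_exponent_le h (show γ / 2 ≤ (1 : ℝ) / 2 by linarith)
    have := Real.rpow_nonneg hs.le (-(3 : ℝ) / 2)
    linarith

lemma norm_mul_rpow_le {γ ε : ℝ} (hγ : γ ∈ Set.Icc (-3 : ℝ) 1) (h0 : 0 ≤ ε) (h1 : ε ≤ 1) (u : E3) :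
    ‖u‖ * (‖u‖ ^ 2 + ε) ^ (γ / 2) ≤ 2 * ((‖u‖ ^ 2)⁻¹ * (1 + ‖u‖ ^ 2) ^ 2) := by
  by_cases hu : u = 0
  · simp [hu]
  have hn : 0 < ‖u‖ := norm_pos_iff.2 hu
  have hs : 0 < ‖u‖ ^ 2 + ε := by positivity
  have hA : (‖u‖ ^ 2 + ε) ^ (-(3 : ℝ) / 2) ≤ (‖u‖ ^ 3)⁻¹ := by
    calc (‖u‖ ^ 2 + ε) ^ (-(3 : ℝ) / 2) ≤ (‖u‖ ^ 2) ^ (-(3 : ℝ) / 2) :=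
          Real.rpow_le_rpow_of_nonpos (by positivity) (by linarith) (by norm_num)
      _ = (‖u‖ ^ 3)⁻¹ := by
          rw [← Real.rpow_natCast, ← Real.rpow_natCast, ← Real.rpow_mul hn.le,
            ← Real.rpow_neg hn.le]
          norm_num
  have hB : (‖u‖ ^ 2 + ε) ^ ((1 : ℝ) / 2) * ‖u‖ ≤ 1 + ‖u‖ ^ 2 := by
    rw [← Real.sqrt_eq_rpow]
    have h3 : √(‖u‖ ^ 2 + ε) ^ 2 = ‖u‖ ^ 2 + ε := Real.sq_sqrt hs.le
    nlinarith [sq_nonneg (√(‖u‖ ^ 2 + ε) - ‖u‖)]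
  calc ‖u‖ * (‖u‖ ^ 2 + ε) ^ (γ / 2)
      ≤ ‖u‖ * ((‖u‖ ^ 2 + ε) ^ (-(3 : ℝ) / 2) + (‖u‖ ^ 2 + ε) ^ ((1 : ℝ) / 2)) := by
        gcongr; exact rpow_half_le hγ hs
    _ = ‖u‖ * (‖u‖ ^ 2 + ε) ^ (-(3 : ℝ) / 2) + (‖u‖ ^ 2 + ε) ^ ((1 : ℝ) / 2) * ‖u‖ := by ring
    _ ≤ ‖u‖ * (‖u‖ ^ 3)⁻¹ + (1 + ‖u‖ ^ 2) := by gcongr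
    _ = (‖u‖ ^ 2)⁻¹ * (1 + ‖u‖ ^ 2 * (1 + ‖u‖ ^ 2)) := by field_simp
    _ ≤ (‖u‖ ^ 2)⁻¹ * (2 * (1 + ‖u‖ ^ 2) ^ 2) := by
        gcongr
        nlinarith [sq_nonneg (‖u‖ ^ 2), sq_nonneg ‖u‖]
    _ = _ := by ring

lemma abs_divReg_le {γ ε : ℝ} (hγ : γ ∈ Set.Icc (-3 : ℝ) 1) (h0 : 0 ≤ ε) (h1 : ε ≤ 1)
    (i : Fin 3) (u : E3) :
    |divReg γ ε i u| ≤ 4 * ((‖u‖ ^ 2)⁻¹ * (1 + ‖u‖ ^ 2) ^ 2) := by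
  have hs : 0 ≤ (‖u‖ ^ 2 + ε) ^ (γ / 2) := by positivity
  unfold divReg
  rw [abs_mul, abs_mul, abs_of_nonneg hs, abs_neg, abs_two]
  have := norm_mul_rpow_le hγ h0 h1 u
  have := mul_le_mul_of_nonneg_left (abs_apply_le_norm u i) hs
  linarith

lemma abs_phiReg_le {γ ε : ℝ} (hγ : γ ∈ Set.Icc (-3 : ℝ) 1) (h0 : 0 ≤ ε) (h1 : ε ≤ 1)
    (i j : Fin 3) (u : E3) :
    |phiReg γ ε i j u| ≤ 4 * (‖u‖⁻¹ * (1 + ‖u‖ ^ 2) ^ 2) := by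
  have hs : 0 ≤ (‖u‖ ^ 2 + ε) ^ (γ / 2) := by positivity
  unfold phiReg
  rw [abs_mul, abs_of_nonneg hs]
  calc (‖u‖ ^ 2 + ε) ^ (γ / 2) * |‖u‖ ^ 2 * (if i = j then 1 else 0) - u i * u j|
      ≤ (‖u‖ ^ 2 + ε) ^ (γ / 2) * (2 * ‖u‖ ^ 2) := by gcongr; exact abs_phi_factor_le u i j
    _ = 2 * ‖u‖ * (‖u‖ * (‖u‖ ^ 2 + ε) ^ (γ / 2)) := by ring
    _ ≤ 2 * ‖u‖ * (2 * ((‖u‖ ^ 2)⁻¹ * (1 + ‖u‖ ^ 2) ^ 2)) := by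
        exact mul_le_mul_of_nonneg_left (norm_mul_rpow_le hγ h0 h1 u) (by positivity)
    _ = _ := by
        rcases eq_or_ne ‖u‖ 0 with h | h
        · simp [h]
        · field_simp
          ring

lemma abs_divReg_le_rho {γ ε : ℝ} (hγ : γ ∈ Set.Icc (-3 : ℝ) 1) (h0 : 0 ≤ ε) (h1 : ε ≤ 1)
    (i : Fin 3) (u : E3) :
    |divReg γ ε i u| ≤ 4 * (rho u * (1 + ‖u‖ ^ 2) ^ 4) := by
  refine (abs_divReg_le hγ h0 h1 i u).trans ?_
  have hw : (1 : ℝ) ≤ 1 + ‖u‖ ^ 2 := by nlinarith [sq_nonneg ‖u‖]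
  have e : rho u * (1 + ‖u‖ ^ 2) ^ 4 = (‖u‖ ^ 2)⁻¹ * (1 + ‖u‖ ^ 2) ^ 3 := by
    unfold rho; field_simp
  rw [e]
  gcongr
  norm_num

lemma abs_phiReg_le_rho {γ ε : ℝ} (hγ : γ ∈ Set.Icc (-3 : ℝ) 1) (h0 : 0 ≤ ε) (h1 : ε ≤ 1)
    (i j : Fin 3) (u : E3) :
    |phiReg γ ε i j u| ≤ 4 * (rho u * (1 + ‖u‖ ^ 2) ^ 4) := by
  refine (abs_phiReg_le hγ h0 h1 i j u).trans ?_
  rcases eq_or_ne ‖u‖ 0 with h | h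
  · simp [h, rho]
  have hn : 0 < ‖u‖ := lt_of_le_of_ne (norm_nonneg _) (Ne.symm h)
  have hw : ‖u‖ ≤ 1 + ‖u‖ ^ 2 := by nlinarith [sq_nonneg (‖u‖ - 1)]
  have e : rho u * (1 + ‖u‖ ^ 2) ^ 4 = (‖u‖ ^ 2)⁻¹ * (1 + ‖u‖ ^ 2) * (1 + ‖u‖ ^ 2) ^ 2 := by
    unfold rho; field_simp
  have e' : ‖u‖⁻¹ = (‖u‖ ^ 2)⁻¹ * ‖u‖ := by field_simp
  rw [e, e']
  gcongr

lemma measurable_phiReg (γ ε : ℝ) (i j : Fin 3) : Measurable (phiReg γ ε i j) := by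
  unfold phiReg; fun_prop

lemma measurable_divReg (γ ε : ℝ) (i : Fin 3) : Measurable (divReg γ ε i) := by
  unfold divReg; fun_prop

lemma hasFDerivAt_coord (i : Fin 3) (u : E3) :
    HasFDerivAt (fun u : E3 => u i) (EuclideanSpace.proj (𝕜 := ℝ) i : E3 →L[ℝ] ℝ) u :=
  (EuclideanSpace.proj (𝕜 := ℝ) i : E3 →L[ℝ] ℝ).hasFDerivAt

lemma hasFDerivAt_normSq_add (ε : ℝ) (u : E3) :
    HasFDerivAt (fun u : E3 => ‖u‖ ^ 2 + ε) (2 • innerSL ℝ u) u :=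
  (hasStrictFDerivAt_norm_sq u).hasFDerivAt.add_const ε

lemma hasFDerivAt_phiReg (γ : ℝ) {ε : ℝ} (hε : 0 < ε) (i j : Fin 3) (u : E3) :
    ∃ L : E3 →L[ℝ] ℝ, HasFDerivAt (phiReg γ ε i j) L u ∧
      ∀ m, L (EuclideanSpace.single m 1) =
        γ * (‖u‖ ^ 2 + ε) ^ (γ / 2 - 1) * u m * (‖u‖ ^ 2 * (if i = j then 1 else 0) - u i * u j) +
        (‖u‖ ^ 2 + ε) ^ (γ / 2) * (2 * u m * (if i = j then 1 else 0) -
          (if i = m then 1 else 0) * u j - u i * (if j = m then 1 else 0)) := by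
  have hs : ‖u‖ ^ 2 + ε ≠ 0 := by positivity
  have h1 := (hasFDerivAt_normSq_add ε u).rpow_const (p := γ / 2) (Or.inl hs)
  have h2 := ((hasStrictFDerivAt_norm_sq u).hasFDerivAt.mul_const
    (if i = j then (1 : ℝ) else 0)).fun_sub
    ((hasFDerivAt_coord i u).fun_mul (hasFDerivAt_coord j u))
  refine ⟨_, h1.fun_mul h2, fun m => ?_⟩
  generalize (if i = j then (1 : ℝ) else 0) = δ
  simp [-mul_ite, -ite_mul, EuclideanSpace.inner_single_right, PiLp.single_apply]
  ring

lemma pd_phiReg (γ : ℝ) {ε : ℝ} (hε : 0 < ε) (i j m : Fin 3) (u : E3) :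
    pd m (phiReg γ ε i j) u =
      γ * (‖u‖ ^ 2 + ε) ^ (γ / 2 - 1) * u m * (‖u‖ ^ 2 * (if i = j then 1 else 0) - u i * u j) +
      (‖u‖ ^ 2 + ε) ^ (γ / 2) * (2 * u m * (if i = j then 1 else 0) -
        (if i = m then 1 else 0) * u j - u i * (if j = m then 1 else 0)) := by
  obtain ⟨L, hL, h⟩ := hasFDerivAt_phiReg γ hε i j u
  unfold pd
  rw [hL.fderiv, h]

lemma sum_pd_phiReg (γ : ℝ) {ε : ℝ} (hε : 0 < ε) (i : Fin 3) (u : E3) :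
    ∑ j, pd j (phiReg γ ε i j) u = divReg γ ε i u := by
  have hn : ‖u‖ ^ 2 = u 0 ^ 2 + u 1 ^ 2 + u 2 ^ 2 := by
    rw [EuclideanSpace.real_norm_sq_eq, Fin.sum_univ_three]
  simp_rw [pd_phiReg γ hε, divReg]
  generalize (‖u‖ ^ 2 + ε) ^ (γ / 2) = A
  generalize (‖u‖ ^ 2 + ε) ^ (γ / 2 - 1) = B
  rw [hn]
  fin_cases i <;> simp [Fin.sum_univ_three] <;> ring

lemma rpow_half_growth {γ ε : ℝ} (hγ : γ ∈ Set.Icc (-3 : ℝ) 1) (hε : 0 < ε) (h1 : ε ≤ 1) (u : E3) :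
    (‖u‖ ^ 2 + ε) ^ (γ / 2) ≤ (ε ^ (-(3 : ℝ) / 2) + 1) * (1 + ‖u‖ ^ 2) := by
  have hs : 0 < ‖u‖ ^ 2 + ε := by positivity
  have hA : (‖u‖ ^ 2 + ε) ^ (-(3 : ℝ) / 2) ≤ ε ^ (-(3 : ℝ) / 2) :=
    Real.rpow_le_rpow_of_nonpos hε (by nlinarith [sq_nonneg ‖u‖]) (by norm_num)
  have hB : (‖u‖ ^ 2 + ε) ^ ((1 : ℝ) / 2) ≤ 1 + ‖u‖ ^ 2 := by
    rw [← Real.sqrt_eq_rpow, Real.sqrt_le_left (by positivity)]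
    nlinarith [sq_nonneg ‖u‖]
  have hw : (1 : ℝ) ≤ 1 + ‖u‖ ^ 2 := by nlinarith [sq_nonneg ‖u‖]
  have hp : 0 ≤ ε ^ (-(3 : ℝ) / 2) := by positivity
  calc _ ≤ _ := rpow_half_le hγ hs
    _ ≤ ε ^ (-(3 : ℝ) / 2) + (1 + ‖u‖ ^ 2) := add_le_add hA hB
    _ ≤ _ := by nlinarith

lemma polyGrowth_phiReg {γ ε : ℝ} (hγ : γ ∈ Set.Icc (-3 : ℝ) 1) (hε : 0 < ε) (h1 : ε ≤ 1)
    (i j : Fin 3) : PolyGrowth (phiReg γ ε i j) := by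
  refine ⟨fun u => (hasFDerivAt_phiReg γ hε i j u).choose_spec.1.differentiableAt,
    ⟨2 * (ε ^ (-(3 : ℝ) / 2) + 1), fun u => ?_⟩, ⟨10 * (ε ^ (-(3 : ℝ) / 2) + 1), fun m u => ?_⟩⟩
  · have hs : 0 ≤ (‖u‖ ^ 2 + ε) ^ (γ / 2) := by positivity
    have hw : (1 : ℝ) ≤ 1 + ‖u‖ ^ 2 := by nlinarith [sq_nonneg ‖u‖]
    unfold phiReg
    rw [abs_mul, abs_of_nonneg hs]
    calc _ ≤ (ε ^ (-(3 : ℝ) / 2) + 1) * (1 + ‖u‖ ^ 2) * (2 * (1 + ‖u‖ ^ 2)) :=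
          mul_le_mul (rpow_half_growth hγ hε h1 u)
            ((abs_phi_factor_le u i j).trans (by linarith)) (abs_nonneg _) (by positivity)
      _ = 2 * (ε ^ (-(3 : ℝ) / 2) + 1) * (1 + ‖u‖ ^ 2) ^ 2 := by ring
      _ ≤ _ := by gcongr; norm_num
  · have hs0 : 0 < ‖u‖ ^ 2 + ε := by positivity
    have hw : (1 : ℝ) ≤ 1 + ‖u‖ ^ 2 := by nlinarith [sq_nonneg ‖u‖]
    have hnw : ‖u‖ ≤ 1 + ‖u‖ ^ 2 := by nlinarith [sq_nonneg (‖u‖ - 1)]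
    have hγ3 : |γ| ≤ 3 := abs_le.2 ⟨hγ.1, hγ.2.trans (by norm_num)⟩
    rw [pd_phiReg γ hε, Real.rpow_sub_one hs0.ne']
    have hS := rpow_half_growth hγ hε h1 u
    have hS0 : 0 ≤ (‖u‖ ^ 2 + ε) ^ (γ / 2) := by positivity
    generalize (‖u‖ ^ 2 + ε) ^ (γ / 2) = S at hS hS0
    have hfrac : ‖u‖ ^ 2 / (‖u‖ ^ 2 + ε) ≤ 1 := by
      rw [div_le_one hs0]; linarith
    have b1 : |γ * (S / (‖u‖ ^ 2 + ε)) * u m * (‖u‖ ^ 2 * (if i = j then 1 else 0) - u i * u j)|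
        ≤ 6 * S * ‖u‖ := by
      rw [abs_mul, abs_mul, abs_mul, abs_div, abs_of_nonneg hS0, abs_of_pos hs0]
      calc _ ≤ 3 * (S / (‖u‖ ^ 2 + ε)) * ‖u‖ * (2 * ‖u‖ ^ 2) := by
            gcongr
            · exact abs_apply_le_norm u m
            · exact abs_phi_factor_le u i j
        _ = 6 * S * ‖u‖ * (‖u‖ ^ 2 / (‖u‖ ^ 2 + ε)) := by ring
        _ ≤ 6 * S * ‖u‖ * 1 := by gcongr
        _ = _ := by ring
    have b2 : |2 * u m * (if i = j then 1 else 0) - (if i = m then 1 else 0) * u j -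
        u i * (if j = m then 1 else 0)| ≤ 4 * ‖u‖ := by
      have e1 := abs_le.1 (abs_apply_le_norm u m)
      have e2 := abs_le.1 (abs_apply_le_norm u i)
      have e3 := abs_le.1 (abs_apply_le_norm u j)
      rw [abs_le]
      split_ifs <;> constructor <;> linarith
    calc _ ≤ 6 * S * ‖u‖ + S * (4 * ‖u‖) := by
          refine (abs_add_le _ _).trans (add_le_add b1 ?_)
          rw [abs_mul, abs_of_nonneg hS0]
          gcongr
      _ = 10 * S * ‖u‖ := by ring
      _ ≤ 10 * ((ε ^ (-(3 : ℝ) / 2) + 1) * (1 + ‖u‖ ^ 2)) * (1 + ‖u‖ ^ 2) := by gcongr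
      _ = 10 * (ε ^ (-(3 : ℝ) / 2) + 1) * (1 + ‖u‖ ^ 2) ^ 2 := by ring
      _ ≤ _ := by gcongr; norm_num

lemma singularKernel_phiReg {γ ε : ℝ} (hγ : γ ∈ Set.Icc (-3 : ℝ) 1) (h0 : 0 ≤ ε) (h1 : ε ≤ 1)
    (i j : Fin 3) : SingularKernel (phiReg γ ε i j) :=
  ⟨measurable_phiReg γ ε i j, 4, by norm_num, abs_phiReg_le_rho hγ h0 h1 i j⟩

lemma singularKernel_divReg {γ ε : ℝ} (hγ : γ ∈ Set.Icc (-3 : ℝ) 1) (h0 : 0 ≤ ε) (h1 : ε ≤ 1)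
    (i : Fin 3) : SingularKernel (divReg γ ε i) :=
  ⟨measurable_divReg γ ε i, 4, by norm_num, abs_divReg_le_rho hγ h0 h1 i⟩

lemma sum_kconv_phiReg_of_pos {γ ε : ℝ} (hγ : γ ∈ Set.Icc (-3 : ℝ) 1) (hε : 0 < ε) (h1 : ε ≤ 1)
    (i : Fin 3) (F : SchwartzMap E3 ℝ) (v : E3) :
    ∑ j, kconv (phiReg γ ε i j) (schwartzPd j F) v = kconv (divReg γ ε i) F v := by
  have hP := fun j => (polyGrowth_phiReg hγ hε h1 i j).comp_sub_left v
  have hj : ∀ j, kconv (phiReg γ ε i j) (schwartzPd j F) v =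
      ∫ w, pd j (phiReg γ ε i j) (v - w) * F w := fun j => by
    rw [kconv_eq_integral_sub, coe_schwartzPd, (hP j).integral_mul_pd, ← integral_neg]
    simp_rw [(polyGrowth_phiReg hγ hε h1 i j).pd_comp_sub_left, neg_mul, neg_neg]
  simp_rw [hj, kconv_eq_integral_sub]
  rw [← integral_finsetSum]
  · simp_rw [← Finset.sum_mul, sum_pd_phiReg γ hε]
  · intro j _
    have := ((hP j).integrable_pd_mul j F).neg
    refine this.congr (.of_forall fun w => ?_)
    simp [(polyGrowth_phiReg hγ hε h1 i j).pd_comp_sub_left]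

lemma tendsto_rpow_mul {γ c : ℝ} {x : ℝ} (hx : x = 0 → c = 0) :
    Tendsto (fun n : ℕ => (x ^ 2 + 1 / ((n : ℝ) + 1)) ^ (γ / 2) * c) atTop
      (𝓝 ((x ^ 2 + 0) ^ (γ / 2) * c)) := by
  by_cases h : x = 0
  · simp [hx h]
  · refine Tendsto.mul_const c ?_
    have : Tendsto (fun n : ℕ => x ^ 2 + 1 / ((n : ℝ) + 1)) atTop (𝓝 (x ^ 2 + 0)) :=
      tendsto_const_nhds.add tendsto_one_div_add_atTop_nhds_zero_nat
    exact this.rpow_const (Or.inl (by positivity))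

/-- The divergence of the Landau kernel, in weak form. -/
lemma sum_kconv_phiReg_zero {γ : ℝ} (hγ : γ ∈ Set.Icc (-3 : ℝ) 1)
    (i : Fin 3) (F : SchwartzMap E3 ℝ) (v : E3) :
    ∑ j, kconv (phiReg γ 0 i j) (schwartzPd j F) v = kconv (divReg γ 0 i) F v := by
  have hpos : ∀ n : ℕ, 0 < 1 / ((n : ℝ) + 1) := fun n => Nat.one_div_pos_of_nat
  have hle : ∀ n : ℕ, 1 / ((n : ℝ) + 1) ≤ 1 := fun n => by
    rw [div_le_one (by positivity)]
    linarith [n.cast_nonneg (α := ℝ)]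
  have hzero : ∀ u : E3, ‖u‖ = 0 → u = 0 := fun u => norm_eq_zero.1
  have hL : Tendsto (fun n : ℕ => ∑ j, kconv (phiReg γ (1 / ((n : ℝ) + 1)) i j) (schwartzPd j F) v)
      atTop (𝓝 (∑ j, kconv (phiReg γ 0 i j) (schwartzPd j F) v)) := by
    refine tendsto_finsetSum _ fun j _ => tendsto_kconv (C := 4) (by norm_num)
      (fun n => measurable_phiReg _ _ _ _)
      (fun n => abs_phiReg_le_rho hγ (hpos n).le (hle n) i j) (fun u => ?_) _ v
    exact tendsto_rpow_mul fun h => by simp [hzero u h]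
  have hR : Tendsto (fun n : ℕ => kconv (divReg γ (1 / ((n : ℝ) + 1)) i) F v)
      atTop (𝓝 (kconv (divReg γ 0 i) F v)) := by
    refine tendsto_kconv (C := 4) (by norm_num) (fun n => measurable_divReg _ _ _)
      (fun n => abs_divReg_le_rho hγ (hpos n).le (hle n) i) (fun u => ?_) _ v
    have := tendsto_rpow_mul (γ := γ) (x := ‖u‖) (c := -2 * u i) fun h => by simp [hzero u h]
    refine (this.congr fun n => ?_).trans (le_of_eq ?_) <;> unfold divReg
    · ring
    · congr 1; ring
  refine tendsto_nhds_unique hL (hR.congr fun n => ?_)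
  exact (sum_kconv_phiReg_of_pos hγ (hpos n) (hle n) i F v).symm

/-! ### Weak formulation of the collision operator -/

lemma PolyGrowth.sub {a b : E3 → ℝ} (ha : PolyGrowth a) (hb : PolyGrowth b) :
    PolyGrowth (fun v => a v - b v) := by
  obtain ⟨A, hA⟩ := ha.bound
  obtain ⟨B, hB⟩ := hb.bound
  obtain ⟨A', hA'⟩ := ha.bound_pd
  obtain ⟨B', hB'⟩ := hb.bound_pd
  refine ⟨ha.diff.sub hb.diff, ⟨A + B, fun v => ?_⟩, ⟨A' + B', fun i v => ?_⟩⟩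
  · rw [add_mul]
    exact (abs_sub _ _).trans (add_le_add (hA v) (hB v))
  · have h : pd i (fun v => a v - b v) v = pd i a v - pd i b v := by
      unfold pd
      rw [((ha.diff v).hasFDerivAt.fun_sub (hb.diff v).hasFDerivAt).fderiv]
      rfl
    rw [h, add_mul]
    exact (abs_sub _ _).trans (add_le_add (hA' i v) (hB' i v))

lemma SingularKernel.integrable_sub {k : E3 → ℝ} (hk : SingularKernel k) (F : SchwartzMap E3 ℝ)
    (v : E3) : Integrable (fun w => k (v - w) * F w) := by
  simpa using (hk.integrable F v).comp_sub_left v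

/-- The `(i, j)` component of the flux whose divergence is the Landau collision operator. -/
def landauFlux (γ : ℝ) (i j : Fin 3) (f g : SchwartzMap E3 ℝ) (v : E3) : ℝ :=
  kconv (phiReg γ 0 i j) f v * schwartzPd j g v -
    kconv (phiReg γ 0 i j) (schwartzPd j f) v * g v

lemma landauQ_eq {γ : ℝ} (hγ : γ ∈ Set.Icc (-3 : ℝ) 1) (f g : SchwartzMap E3 ℝ) (v : E3) :
    landauQ γ f g v = ∑ i, ∑ j, pd i (landauFlux γ i j f g) v := by
  unfold landauQ
  refine Finset.sum_congr rfl fun i _ => Finset.sum_congr rfl fun j _ => ?_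
  have hk := singularKernel_phiReg hγ le_rfl zero_le_one i j
  congr 1
  ext v'
  rw [landauFlux, kconv_eq_integral_sub, kconv_eq_integral_sub, ← integral_mul_const,
    ← integral_mul_const, ← integral_sub ((hk.integrable_sub f v').mul_const _)
    ((hk.integrable_sub _ v').mul_const _)]
  simp_rw [phiK_eq_phiReg, coe_schwartzPd]
  congr 1
  ext w
  ring

lemma polyGrowth_landauFlux {γ : ℝ} (hγ : γ ∈ Set.Icc (-3 : ℝ) 1) (i j : Fin 3)
    (f g : SchwartzMap E3 ℝ) : PolyGrowth (landauFlux γ i j f g) := by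
  have hk := singularKernel_phiReg hγ le_rfl zero_le_one i j
  exact ((hk.polyGrowth f).mul_schwartz _).sub ((hk.polyGrowth (schwartzPd j f)).mul_schwartz _)

lemma integral_landauFlux_mul {γ : ℝ} (hγ : γ ∈ Set.Icc (-3 : ℝ) 1) (i j : Fin 3)
    (f g w : SchwartzMap E3 ℝ) :
    ∫ v, landauFlux γ i j f g v * w v =
      -(2 * ∫ v, kconv (phiReg γ 0 i j) (schwartzPd j f) v * w v * g v) -
        ∫ v, kconv (phiReg γ 0 i j) f v * schwartzPd j w v * g v := by
  have hk := singularKernel_phiReg hγ le_rfl zero_le_one i j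
  have hT := hk.polyGrowth f
  have hT' := hk.polyGrowth (schwartzPd j f)
  have e : ∀ v, landauFlux γ i j f g v * w v = kconv (phiReg γ 0 i j) f v * w v * schwartzPd j g v -
      kconv (phiReg γ 0 i j) (schwartzPd j f) v * w v * g v := fun v => by
    unfold landauFlux; ring
  have hi := (hT'.mul_schwartz w).integrable_mul g
  have hi2 := (hT.mul_schwartz (schwartzPd j w)).integrable_mul g
  simp_rw [e]
  rw [integral_sub ((hT.mul_schwartz w).integrable_mul (schwartzPd j g)) hi]
  rw [coe_schwartzPd j g, hT.integral_mul_mul_pd w g j, hk.pd_kconv, ← coe_schwartzPd j w]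
  simp_rw [add_mul]
  rw [integral_add hi hi2]
  ring

/-- Weak form of the Landau collision operator. -/
lemma integral_landauQ_mul {γ : ℝ} (hγ : γ ∈ Set.Icc (-3 : ℝ) 1) (f g h : SchwartzMap E3 ℝ) :
    ∫ v, landauQ γ f g v * h v =
      ∑ i, (2 * (∫ v, kconv (divReg γ 0 i) f v * schwartzPd i h v * g v) +
        ∑ j, ∫ v, kconv (phiReg γ 0 i j) f v * schwartzPd j (schwartzPd i h) v * g v) := by
  simp_rw [landauQ_eq hγ, Finset.sum_mul]
  rw [integral_finsetSum _ fun i _ => integrable_finsetSum _ fun j _ =>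
    (polyGrowth_landauFlux hγ i j f g).integrable_pd_mul i h]
  refine Finset.sum_congr rfl fun i _ => ?_
  rw [integral_finsetSum _ fun j _ => (polyGrowth_landauFlux hγ i j f g).integrable_pd_mul i h]
  have hj : ∀ j, ∫ v, pd i (landauFlux γ i j f g) v * h v =
      2 * (∫ v, kconv (phiReg γ 0 i j) (schwartzPd j f) v * schwartzPd i h v * g v) +
        ∫ v, kconv (phiReg γ 0 i j) f v * schwartzPd j (schwartzPd i h) v * g v := fun j => by
    have e := (polyGrowth_landauFlux hγ i j f g).integral_mul_pd i h
    rw [← coe_schwartzPd, integral_landauFlux_mul hγ] at e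
    linarith
  simp_rw [hj]
  rw [Finset.sum_add_distrib, ← Finset.mul_sum, ← integral_finsetSum]
  · simp_rw [← Finset.sum_mul, sum_kconv_phiReg_zero hγ]
  · intro j _
    exact (((singularKernel_phiReg hγ le_rfl zero_le_one i j).polyGrowth
      (schwartzPd j f)).mul_schwartz _).integrable_mul g
/-! ### Hardy's inequality -/

/-- The regularized vector field `u / |u|²`. -/
def hardyField (ε : ℝ) (i : Fin 3) (u : E3) : ℝ := u i * (‖u‖ ^ 2 + ε)⁻¹

lemma hasFDerivAt_hardyField {ε : ℝ} (hε : 0 < ε) (i : Fin 3) (u : E3) :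
    ∃ L : E3 →L[ℝ] ℝ, HasFDerivAt (hardyField ε i) L u ∧
      ∀ m, L (EuclideanSpace.single m 1) =
        (if i = m then 1 else 0) * (‖u‖ ^ 2 + ε)⁻¹ - 2 * u i * u m * (‖u‖ ^ 2 + ε)⁻¹ ^ 2 := by
  have hs : ‖u‖ ^ 2 + ε ≠ 0 := by positivity
  have h1 := (hasDerivAt_inv hs).comp_hasFDerivAt u (hasFDerivAt_normSq_add ε u)
  refine ⟨_, (hasFDerivAt_coord i u).fun_mul h1, fun m => ?_⟩
  simp [-mul_ite, -ite_mul, EuclideanSpace.inner_single_right, PiLp.single_apply]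
  ring

lemma pd_hardyField {ε : ℝ} (hε : 0 < ε) (i m : Fin 3) (u : E3) :
    pd m (hardyField ε i) u =
      (if i = m then 1 else 0) * (‖u‖ ^ 2 + ε)⁻¹ - 2 * u i * u m * (‖u‖ ^ 2 + ε)⁻¹ ^ 2 := by
  obtain ⟨L, hL, h⟩ := hasFDerivAt_hardyField hε i u
  unfold pd
  rw [hL.fderiv, h]

lemma polyGrowth_hardyField {ε : ℝ} (hε : 0 < ε) (i : Fin 3) : PolyGrowth (hardyField ε i) := by
  refine ⟨fun u => (hasFDerivAt_hardyField hε i u).choose_spec.1.differentiableAt,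
    ⟨ε⁻¹, fun u => ?_⟩, ⟨3 * ε⁻¹, fun m u => ?_⟩⟩
  all_goals
    have hw : (1 : ℝ) ≤ 1 + ‖u‖ ^ 2 := by nlinarith [sq_nonneg ‖u‖]
    have hs : (‖u‖ ^ 2 + ε)⁻¹ ≤ ε⁻¹ := by gcongr; nlinarith [sq_nonneg ‖u‖]
    have hs0 : 0 < (‖u‖ ^ 2 + ε)⁻¹ := by positivity
  · unfold hardyField
    rw [abs_mul, abs_of_pos hs0, mul_comm]
    gcongr
    refine (abs_apply_le_norm u i).trans ?_
    calc ‖u‖ ≤ 1 + ‖u‖ ^ 2 := by nlinarith [sq_nonneg (‖u‖ - 1)]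
      _ ≤ _ := le_self_pow₀ hw (by norm_num)
  · rw [pd_hardyField hε]
    have hfrac : ‖u‖ ^ 2 * (‖u‖ ^ 2 + ε)⁻¹ ≤ 1 := by
      rw [← div_eq_mul_inv, div_le_one (by positivity)]; linarith
    have b2 : |2 * u i * u m * (‖u‖ ^ 2 + ε)⁻¹ ^ 2| ≤ 2 * (‖u‖ ^ 2 + ε)⁻¹ := by
      rw [abs_mul, abs_mul, abs_mul, abs_of_pos (pow_pos hs0 2), abs_two]
      calc _ ≤ 2 * ‖u‖ * ‖u‖ * (‖u‖ ^ 2 + ε)⁻¹ ^ 2 := by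
            gcongr <;> exact abs_apply_le_norm u _
        _ = 2 * (‖u‖ ^ 2 + ε)⁻¹ * (‖u‖ ^ 2 * (‖u‖ ^ 2 + ε)⁻¹) := by ring
        _ ≤ 2 * (‖u‖ ^ 2 + ε)⁻¹ * 1 := by gcongr
        _ = _ := by ring
    have b1 : |(if i = m then 1 else 0) * (‖u‖ ^ 2 + ε)⁻¹| ≤ (‖u‖ ^ 2 + ε)⁻¹ := by
      split_ifs <;> simp [abs_of_pos hs0, hs0.le]
    calc _ ≤ (‖u‖ ^ 2 + ε)⁻¹ + 2 * (‖u‖ ^ 2 + ε)⁻¹ := (abs_sub _ _).trans (add_le_add b1 b2)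
      _ = 3 * (‖u‖ ^ 2 + ε)⁻¹ := by ring
      _ ≤ 3 * ε⁻¹ * 1 := by linarith
      _ ≤ _ := by gcongr; exact one_le_pow₀ hw

lemma inv_le_sum_pd_hardyField {ε : ℝ} (hε : 0 < ε) (u : E3) :
    (‖u‖ ^ 2 + ε)⁻¹ ≤ ∑ i, pd i (hardyField ε i) u := by
  have hn : ‖u‖ ^ 2 = u 0 ^ 2 + u 1 ^ 2 + u 2 ^ 2 := by
    rw [EuclideanSpace.real_norm_sq_eq, Fin.sum_univ_three]
  have hfrac : ‖u‖ ^ 2 * (‖u‖ ^ 2 + ε)⁻¹ ≤ 1 := by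
    rw [← div_eq_mul_inv, div_le_one (by positivity)]; linarith
  have hs0 : 0 < (‖u‖ ^ 2 + ε)⁻¹ := by positivity
  have e : ∑ i, pd i (hardyField ε i) u =
      3 * (‖u‖ ^ 2 + ε)⁻¹ - 2 * (‖u‖ ^ 2 + ε)⁻¹ * (‖u‖ ^ 2 * (‖u‖ ^ 2 + ε)⁻¹) := by
    simp_rw [pd_hardyField hε]
    generalize (‖u‖ ^ 2 + ε)⁻¹ = s
    rw [hn]
    simp [Fin.sum_univ_three]
    ring
  rw [e]
  nlinarith

lemma sum_hardyField_sq_le {ε : ℝ} (hε : 0 < ε) (u : E3) :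
    ∑ i, hardyField ε i u ^ 2 ≤ (‖u‖ ^ 2 + ε)⁻¹ := by
  have hfrac : ‖u‖ ^ 2 * (‖u‖ ^ 2 + ε)⁻¹ ≤ 1 := by
    rw [← div_eq_mul_inv, div_le_one (by positivity)]; linarith
  have hs0 : 0 < (‖u‖ ^ 2 + ε)⁻¹ := by positivity
  have e : ∑ i, hardyField ε i u ^ 2 = (‖u‖ ^ 2 + ε)⁻¹ * (‖u‖ ^ 2 * (‖u‖ ^ 2 + ε)⁻¹) := by
    simp_rw [hardyField, mul_pow]
    rw [← Finset.sum_mul, ← EuclideanSpace.real_norm_sq_eq]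
    ring
  rw [e]
  nlinarith

lemma integrable_schwartz_sq (W : SchwartzMap E3 ℝ) : Integrable (fun v => W v ^ 2) :=
  (W.memLp 2 volume).integrable_sq

lemma hardy_regularized {ε : ℝ} (hε : 0 < ε) (W : SchwartzMap E3 ℝ) (c : E3) :
    Integrable (fun v => (‖c - v‖ ^ 2 + ε)⁻¹ * W v ^ 2) ∧
    ∫ v, (‖c - v‖ ^ 2 + ε)⁻¹ * W v ^ 2 ≤ 4 * ∑ i, ∫ v, schwartzPd i W v ^ 2 := by
  have hY := fun i => polyGrowth_hardyField hε i
  have ha := fun i => (hY i).comp_sub_left c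
  have hI : Integrable (fun v => (‖c - v‖ ^ 2 + ε)⁻¹ * W v ^ 2) := by
    refine (integrable_schwartz_sq W).bdd_mul (c := ε⁻¹)
      (by fun_prop : Measurable fun v : E3 => (‖c - v‖ ^ 2 + ε)⁻¹).aestronglyMeasurable
      (.of_forall fun v => ?_)
    rw [Real.norm_of_nonneg (by positivity)]
    gcongr
    nlinarith [sq_nonneg ‖c - v‖]
  have hA : ∀ i, Integrable (fun v => hardyField ε i (c - v) * W v * schwartzPd i W v) :=
    fun i => ((ha i).mul_schwartz W).integrable_mul (schwartzPd i W)
  have hB : ∀ i, Integrable (fun v => pd i (hardyField ε i) (c - v) * W v ^ 2) := fun i => by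
    have h2 := ((((ha i).mul_schwartz W).integrable_pd_mul i W).sub (hA i)).neg
    refine h2.congr (.of_forall fun v => ?_)
    simp only [Pi.neg_apply, Pi.sub_apply, (ha i).pd_mul, coe_schwartzPd,
      (hY i).pd_comp_sub_left]
    ring
  have hparts : ∀ i, ∫ v, pd i (hardyField ε i) (c - v) * W v ^ 2 =
      2 * ∫ v, hardyField ε i (c - v) * W v * schwartzPd i W v := fun i => by
    have h := (ha i).integral_mul_mul_pd W W i
    rw [← coe_schwartzPd] at h
    have e : ∀ v, (pd i (fun v => hardyField ε i (c - v)) v * W v +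
        hardyField ε i (c - v) * schwartzPd i W v) * W v =
        hardyField ε i (c - v) * W v * schwartzPd i W v -
        pd i (hardyField ε i) (c - v) * W v ^ 2 := fun v => by
      rw [(hY i).pd_comp_sub_left]; ring
    simp_rw [e] at h
    rw [integral_sub (hA i) (hB i)] at h
    linarith
  refine ⟨hI, ?_⟩
  have h1 : ∫ v, (‖c - v‖ ^ 2 + ε)⁻¹ * W v ^ 2 ≤
      ∑ i, 2 * ∫ v, hardyField ε i (c - v) * W v * schwartzPd i W v := by
    simp_rw [← hparts]
    rw [← integral_finsetSum _ fun i _ => hB i]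
    refine integral_mono hI (integrable_finsetSum _ fun i _ => hB i) fun v => ?_
    simp only [← Finset.sum_mul]
    gcongr
    exact inv_le_sum_pd_hardyField hε _
  have hD : ∀ i, Integrable (fun v => schwartzPd i W v ^ 2) := fun i => integrable_schwartz_sq _
  have h2 : ∑ i, 2 * ∫ v, hardyField ε i (c - v) * W v * schwartzPd i W v ≤
      1 / 2 * (∫ v, (‖c - v‖ ^ 2 + ε)⁻¹ * W v ^ 2) + 2 * ∑ i, ∫ v, schwartzPd i W v ^ 2 := by
    rw [← Finset.mul_sum, ← integral_finsetSum _ fun i _ => hA i,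
      ← integral_finsetSum _ fun i _ => hD i, ← integral_const_mul, ← integral_const_mul,
      ← integral_const_mul, ← integral_add (hI.const_mul _)
      ((integrable_finsetSum _ fun i _ => hD i).const_mul _)]
    refine integral_mono ((integrable_finsetSum _ fun i _ => hA i).const_mul _)
      ((hI.const_mul _).add ((integrable_finsetSum _ fun i _ => hD i).const_mul _)) fun v => ?_
    have hs := mul_le_mul_of_nonneg_right (sum_hardyField_sq_le hε (c - v)) (sq_nonneg (W v))
    have hy : ∀ i, 2 * (hardyField ε i (c - v) * W v * schwartzPd i W v) ≤
        1 / 2 * (hardyField ε i (c - v) ^ 2 * W v ^ 2) + 2 * schwartzPd i W v ^ 2 := fun i => by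
      nlinarith [sq_nonneg (hardyField ε i (c - v) * W v - 2 * schwartzPd i W v)]
    simp only [Finset.mul_sum, Finset.sum_mul] at hs ⊢
    calc _ ≤ ∑ i, (1 / 2 * (hardyField ε i (c - v) ^ 2 * W v ^ 2) + 2 * schwartzPd i W v ^ 2) :=
          Finset.sum_le_sum fun i _ => hy i
      _ = 1 / 2 * (∑ i, hardyField ε i (c - v) ^ 2 * W v ^ 2) + ∑ i, 2 * schwartzPd i W v ^ 2 := by
          rw [Finset.sum_add_distrib, Finset.mul_sum]
      _ ≤ _ := by gcongr
  linarith

/-- Hardy's inequality in `ℝ³`. -/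
lemma hardy (W : SchwartzMap E3 ℝ) (c : E3) :
    ∫⁻ v, ENNReal.ofReal ((‖c - v‖ ^ 2)⁻¹ * W v ^ 2) ≤
      ENNReal.ofReal (4 * ∑ i, ∫ v, schwartzPd i W v ^ 2) := by
  have hpos : ∀ n : ℕ, 0 < 1 / ((n : ℝ) + 1) := fun n => Nat.one_div_pos_of_nat
  have hlim : ∀ v, ENNReal.ofReal ((‖c - v‖ ^ 2)⁻¹ * W v ^ 2) ≤
      liminf (fun n : ℕ => ENNReal.ofReal ((‖c - v‖ ^ 2 + 1 / ((n : ℝ) + 1))⁻¹ * W v ^ 2)) atTop := by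
    intro v
    by_cases h : ‖c - v‖ = 0
    · simp [h]
    · have h1 : Tendsto (fun n : ℕ => ‖c - v‖ ^ 2 + 1 / ((n : ℝ) + 1)) atTop
          (𝓝 (‖c - v‖ ^ 2 + 0)) :=
        tendsto_const_nhds.add tendsto_one_div_add_atTop_nhds_zero_nat
      rw [add_zero] at h1
      exact (ENNReal.tendsto_ofReal ((h1.inv₀ (by positivity)).mul_const _)).liminf_eq.ge
  calc _ ≤ _ := lintegral_mono hlim
    _ ≤ _ := lintegral_liminf_le' fun n =>
        (hardy_regularized (hpos n) W c).1.1.aemeasurable.ennreal_ofReal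
    _ ≤ _ := by
        refine liminf_le_of_le (by isBoundedDefault) fun b hb => ?_
        obtain ⟨n, hn⟩ := hb.exists
        refine hn.trans ?_
        rw [← ofReal_integral_eq_lintegral_ofReal (hardy_regularized (hpos n) W c).1
          (.of_forall fun v => by positivity)]
        exact ENNReal.ofReal_le_ofReal (hardy_regularized (hpos n) W c).2
/-! ### Weighted estimates -/

lemma jb_pos (v : E3) : 0 < jb v := by unfold jb; positivity

lemma jb_sq (v : E3) : jb v ^ 2 = 1 + ‖v‖ ^ 2 := by
  unfold jb
  rw [← Real.sqrt_eq_rpow, Real.sq_sqrt (by positivity)]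

lemma jb_rpow (v : E3) (l : ℝ) : jb v ^ l = (1 + ‖v‖ ^ 2) ^ (l / 2) := by
  unfold jb
  rw [← Real.rpow_mul (by positivity)]
  congr 1
  ring

lemma measurable_jb : Measurable jb := by unfold jb; fun_prop

/-- Multiplication by the weight `⟨v⟩^l` on Schwartz functions. -/
def jbMul (l : ℝ) (F : SchwartzMap E3 ℝ) : SchwartzMap E3 ℝ :=
  SchwartzMap.smulLeftCLM ℝ (fun v : E3 => (1 + ‖v‖ ^ 2) ^ (l / 2)) F

lemma jbMul_apply (l : ℝ) (F : SchwartzMap E3 ℝ) (v : E3) : jbMul l F v = jb v ^ l * F v := by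
  unfold jbMul
  rw [SchwartzMap.smulLeftCLM_apply_apply
    (Function.hasTemperateGrowth_one_add_norm_sq_rpow E3 (l / 2)), jb_rpow, smul_eq_mul]

lemma nrm2_sq (l : ℝ) (F : SchwartzMap E3 ℝ) : nrm2 l F ^ 2 = ∫ v, jbMul l F v ^ 2 := by
  unfold nrm2
  rw [Real.sq_sqrt (integral_nonneg fun v => sq_nonneg _)]
  simp_rw [jbMul_apply]

lemma nrm2_nonneg (l : ℝ) (F : E3 → ℝ) : 0 ≤ nrm2 l F := Real.sqrt_nonneg _

lemma real_enorm_sq (x : ℝ) : ‖x‖ₑ ^ 2 = ENNReal.ofReal (x ^ 2) := by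
  rw [Real.enorm_eq_ofReal_abs, ← ENNReal.ofReal_pow (abs_nonneg x), sq_abs]

lemma lintegral_enorm_jbMul_sq (l : ℝ) (F : SchwartzMap E3 ℝ) :
    ∫⁻ v, ‖jbMul l F v‖ₑ ^ 2 = ENNReal.ofReal (nrm2 l F ^ 2) := by
  simp_rw [real_enorm_sq]
  rw [nrm2_sq, ofReal_integral_eq_lintegral_ofReal (integrable_schwartz_sq _)
    (.of_forall fun v => sq_nonneg _)]

lemma sq_lintegral_mul_le {a b : E3 → ℝ≥0∞} (ha : AEMeasurable a volume)
    (hb : AEMeasurable b volume) :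
    (∫⁻ v, a v * b v) ^ 2 ≤ (∫⁻ v, a v ^ 2) * ∫⁻ v, b v ^ 2 := by
  have h := ENNReal.lintegral_mul_le_Lp_mul_Lq volume Real.HolderConjugate.two_two ha hb
  simp only [Pi.mul_apply, ENNReal.rpow_two] at h
  calc _ ≤ _ := pow_le_pow_left' h 2
    _ = _ := by
      rw [mul_pow, ← ENNReal.rpow_two, ← ENNReal.rpow_two, ← ENNReal.rpow_mul, ← ENNReal.rpow_mul]
      norm_num

lemma weight_le (u v : E3) : (1 + ‖u‖ ^ 2) ^ 2 ≤ 8 * (jb v ^ 5 * jb (v - u) ^ 5) * (jb u)⁻¹ := by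
  have hu := jb_pos u
  have hv := jb_pos v
  have hw := jb_pos (v - u)
  have h := peetre u v
  rw [← jb_sq, ← jb_sq, ← jb_sq] at h
  have h1 : jb u ≤ 3 / 2 * (jb v * jb (v - u)) := by
    refine le_of_sq_le_sq ?_ (by positivity)
    nlinarith [mul_pos (pow_pos hv 2) (pow_pos hw 2)]
  rw [← div_eq_mul_inv, le_div_iff₀ hu, ← jb_sq]
  calc (jb u ^ 2) ^ 2 * jb u = jb u ^ 5 := by ring
    _ ≤ (3 / 2 * (jb v * jb (v - u))) ^ 5 := by gcongr
    _ = (3 / 2) ^ 5 * (jb v ^ 5 * jb (v - u) ^ 5) := by ring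
    _ ≤ _ := by gcongr; norm_num

lemma enorm_kconv_sq_le {k b : E3 → ℝ} (hb : Measurable b)
    (hk : ∀ u, |k u| ≤ 4 * (‖u‖⁻¹ * (1 + ‖u‖ ^ 2) ^ 2) * |b u|) (f : SchwartzMap E3 ℝ) (v : E3) :
    ‖kconv k f v‖ₑ ^ 2 ≤ ‖32 * jb v ^ 5‖ₑ ^ 2 *
      ((∫⁻ u, ‖rho u‖ₑ) * ∫⁻ u, (‖b u‖ₑ * ‖jbMul 5 f (v - u)‖ₑ) ^ 2) := by
  have hS : ∀ u : E3, ‖‖u‖⁻¹ * (jb u)⁻¹‖ₑ ^ 2 = ‖rho u‖ₑ := fun u => by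
    rw [← enorm_pow, mul_pow, inv_pow, inv_pow, jb_sq]; rfl
  have hpt : ∀ u, ‖k u * f (v - u)‖ₑ ≤ ‖32 * jb v ^ 5‖ₑ *
      (‖‖u‖⁻¹ * (jb u)⁻¹‖ₑ * (‖b u‖ₑ * ‖jbMul 5 f (v - u)‖ₑ)) := fun u => by
    have hu := jb_pos u
    have hv := jb_pos v
    have hw := jb_pos (v - u)
    rw [← enorm_mul, ← enorm_mul, ← enorm_mul]
    refine enorm_le_iff_norm_le.2 ?_
    rw [norm_mul, jbMul_apply, Real.norm_eq_abs, Real.norm_eq_abs]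
    norm_num
    rw [abs_of_pos hu, abs_of_pos hv, abs_of_pos hw]
    calc |k u| * |f (v - u)| ≤ 4 * (‖u‖⁻¹ * (8 * (jb v ^ 5 * jb (v - u) ^ 5) * (jb u)⁻¹)) * |b u| *
          |f (v - u)| := by
          gcongr
          refine (hk u).trans ?_
          gcongr
          exact weight_le u v
      _ = _ := by ring
  have h1 : ‖kconv k f v‖ₑ ≤ ‖32 * jb v ^ 5‖ₑ *
      ∫⁻ u, ‖‖u‖⁻¹ * (jb u)⁻¹‖ₑ * (‖b u‖ₑ * ‖jbMul 5 f (v - u)‖ₑ) := by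
    rw [← lintegral_const_mul']
    · exact (enorm_integral_le_lintegral_enorm _).trans (lintegral_mono hpt)
    · exact enorm_ne_top
  calc _ ≤ _ := pow_le_pow_left' h1 2
    _ ≤ _ := by
      rw [mul_pow]
      gcongr
      refine (sq_lintegral_mul_le ?_ ?_).trans (le_of_eq ?_)
      · exact (measurable_norm.inv.mul measurable_jb.inv).enorm.aemeasurable
      · exact (hb.enorm.mul ((jbMul 5 f).continuous.measurable.comp
          (measurable_const.sub measurable_id)).enorm).aemeasurable
      · simp_rw [hS]

/-- Weighted bound for the trilinear form associated with a convolution kernel. -/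
lemma sq_integral_kconv_mul_le {k b : E3 → ℝ} (hb : Measurable b)
    (hk : ∀ u, |k u| ≤ 4 * (‖u‖⁻¹ * (1 + ‖u‖ ^ 2) ^ 2) * |b u|) (f g w : SchwartzMap E3 ℝ)
    (hkm : AEMeasurable (kconv k f) volume)
    {l M : ℝ} (hM0 : 0 ≤ M)
    (hM : ∀ c, ∫⁻ v, (‖b (v - c)‖ₑ * ‖jbMul l w v‖ₑ) ^ 2 ≤ ENNReal.ofReal M) :
    (∫ v, kconv k f v * w v * g v) ^ 2 ≤
      32 ^ 2 * (∫ u, rho u) * nrm2 5 f ^ 2 * nrm2 (5 - l) g ^ 2 * M := by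
  have hJ : ∫⁻ u, ‖rho u‖ₑ = ENNReal.ofReal (∫ u, rho u) := by
    rw [ofReal_integral_eq_lintegral_ofReal integrable_rho (.of_forall rho_nonneg)]
    simp_rw [Real.enorm_of_nonneg (rho_nonneg _)]
  have hJ0 : 0 ≤ ∫ u, rho u := integral_nonneg rho_nonneg
  have hfm : Measurable (jbMul 5 f) := (jbMul 5 f).continuous.measurable
  have hwm : Measurable (jbMul l w) := (jbMul l w).continuous.measurable
  have hsplit : ∀ v, ‖kconv k f v * w v * g v‖ₑ =
      (‖kconv k f v‖ₑ * ‖(jb v ^ 5)⁻¹‖ₑ * ‖jbMul l w v‖ₑ) * ‖jbMul (5 - l) g v‖ₑ := fun v => by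
    have hv := jb_pos v
    simp_rw [← enorm_mul, jbMul_apply]
    rw [Real.rpow_sub hv]
    have : jb v ^ l ≠ 0 := (Real.rpow_pos_of_pos hv l).ne'
    congr 1
    norm_num
    field_simp
  have hpt : ∀ v, (‖kconv k f v‖ₑ * ‖(jb v ^ 5)⁻¹‖ₑ * ‖jbMul l w v‖ₑ) ^ 2 ≤
      32 ^ 2 * ENNReal.ofReal (∫ u, rho u) *
        ∫⁻ c, ‖jbMul 5 f c‖ₑ ^ 2 * (‖b (v - c)‖ₑ * ‖jbMul l w v‖ₑ) ^ 2 := fun v => by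
    have hv := jb_pos v
    have e1 : ∫⁻ u, (‖b u‖ₑ * ‖jbMul 5 f (v - u)‖ₑ) ^ 2 =
        ∫⁻ c, (‖b (v - c)‖ₑ * ‖jbMul 5 f c‖ₑ) ^ 2 := by
      rw [← lintegral_sub_left_eq_self _ v]
      simp
    have e2 : ‖32 * jb v ^ 5‖ₑ ^ 2 * ‖(jb v ^ 5)⁻¹‖ₑ ^ 2 = 32 ^ 2 := by
      rw [← mul_pow, ← enorm_mul, mul_assoc, mul_inv_cancel₀ (by positivity), mul_one,
        Real.enorm_of_nonneg (by norm_num), ENNReal.ofReal_ofNat]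
    have e3 : ∫⁻ c, ‖jbMul 5 f c‖ₑ ^ 2 * (‖b (v - c)‖ₑ * ‖jbMul l w v‖ₑ) ^ 2 =
        (∫⁻ c, (‖b (v - c)‖ₑ * ‖jbMul 5 f c‖ₑ) ^ 2) * ‖jbMul l w v‖ₑ ^ 2 := by
      rw [← lintegral_mul_const' _ _ (by finiteness)]
      congr 1
      ext c
      ring
    rw [e3, ← hJ, ← e1, mul_pow, mul_pow, ← e2]
    calc _ ≤ ‖32 * jb v ^ 5‖ₑ ^ 2 *
      ((∫⁻ u, ‖rho u‖ₑ) * ∫⁻ u, (‖b u‖ₑ * ‖jbMul 5 f (v - u)‖ₑ) ^ 2) * ‖(jb v ^ 5)⁻¹‖ₑ ^ 2 *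
          ‖jbMul l w v‖ₑ ^ 2 := by gcongr; exact enorm_kconv_sq_le hb hk f v
      _ = _ := by ring
  have hmain : ∫⁻ v, (‖kconv k f v‖ₑ * ‖(jb v ^ 5)⁻¹‖ₑ * ‖jbMul l w v‖ₑ) ^ 2 ≤
      32 ^ 2 * ENNReal.ofReal (∫ u, rho u) * (ENNReal.ofReal (nrm2 5 f ^ 2) * ENNReal.ofReal M) := by
    refine (lintegral_mono hpt).trans ?_
    rw [lintegral_const_mul' _ _ (by finiteness)]
    gcongr
    rw [lintegral_lintegral_swap]
    · calc _ ≤ ∫⁻ c, ‖jbMul 5 f c‖ₑ ^ 2 * ENNReal.ofReal M := by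
            refine lintegral_mono fun c => ?_
            rw [lintegral_const_mul' _ _ (by finiteness)]
            gcongr
            exact hM c
        _ = _ := by
            rw [lintegral_mul_const' _ _ ENNReal.ofReal_ne_top, lintegral_enorm_jbMul_sq]
    · refine Measurable.aemeasurable ?_
      have h1 : Measurable fun p : E3 × E3 => b (p.1 - p.2) :=
        hb.comp (measurable_fst.sub measurable_snd)
      exact ((hfm.comp measurable_snd).enorm.pow_const 2).mul
        ((h1.enorm.mul (hwm.comp measurable_fst).enorm).pow_const 2)
  have hfinal : ENNReal.ofReal ((∫ v, kconv k f v * w v * g v) ^ 2) ≤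
      ENNReal.ofReal (32 ^ 2 * (∫ u, rho u) * nrm2 5 f ^ 2 * nrm2 (5 - l) g ^ 2 * M) := by
    calc _ = ‖∫ v, kconv k f v * w v * g v‖ₑ ^ 2 := (real_enorm_sq _).symm
      _ ≤ (∫⁻ v, ‖kconv k f v * w v * g v‖ₑ) ^ 2 :=
          pow_le_pow_left' (enorm_integral_le_lintegral_enorm _) 2
      _ ≤ (32 ^ 2 * ENNReal.ofReal (∫ u, rho u) *
            (ENNReal.ofReal (nrm2 5 f ^ 2) * ENNReal.ofReal M)) *
            ENNReal.ofReal (nrm2 (5 - l) g ^ 2) := by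
          simp_rw [hsplit]
          refine (sq_lintegral_mul_le ?_ ?_).trans ?_
          · exact (hkm.enorm.mul
              (measurable_jb.pow_const 5).inv.enorm.aemeasurable).mul hwm.enorm.aemeasurable
          · exact (jbMul (5 - l) g).continuous.measurable.enorm.aemeasurable
          · rw [lintegral_enorm_jbMul_sq]
            gcongr
      _ = _ := by
          have h32 : (32 : ℝ≥0∞) ^ 2 = ENNReal.ofReal (32 ^ 2) := by
            rw [ENNReal.ofReal_pow (by norm_num)]; norm_num
          rw [h32, ← ENNReal.ofReal_mul (by positivity), ← ENNReal.ofReal_mul (by positivity),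
            ← ENNReal.ofReal_mul (by positivity), ← ENNReal.ofReal_mul (by positivity)]
          congr 1
          ring
  exact (ENNReal.ofReal_le_ofReal_iff (by positivity)).1 hfinal
/-! ### Control by the weighted Sobolev norm -/

lemma pd_pd_comm (h : SchwartzMap E3 ℝ) (i j : Fin 3) : pd i (pd j h) = pd j (pd i h) := by
  have hd : Differentiable ℝ (fderiv ℝ h) :=
    (SchwartzMap.fderivCLM ℝ E3 ℝ h).differentiable
  have key : ∀ (i j : Fin 3) (v : E3), pd i (pd j h) v =
      fderiv ℝ (fderiv ℝ h) v (EuclideanSpace.single i 1) (EuclideanSpace.single j 1) := by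
    intro i j v
    unfold pd
    rw [((hd v).hasFDerivAt.clm_apply (hasFDerivAt_const _ v)).fderiv]
    simp
  ext v
  rw [key, key]
  exact second_derivative_symmetric (fun y => h.hasFDerivAt y) (hd v).hasFDerivAt _ _

lemma nrm2_pdM_le {l : ℝ} (h : E3 → ℝ) {β : ℕ × ℕ × ℕ} (hβ : β ∈ multiIdx 2) :
    nrm2 l (pdM β h) ≤ H2w l h :=
  Finset.single_le_sum (f := fun β => nrm2 l (pdM β h)) (fun _ _ => nrm2_nonneg l _) hβ

lemma nrm2_pd_le (l : ℝ) (h : E3 → ℝ) (i : Fin 3) : nrm2 l (pd i h) ≤ H2w l h := by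
  fin_cases i
  · exact nrm2_pdM_le h (β := (1, 0, 0)) (by simp [multiIdx])
  · exact nrm2_pdM_le h (β := (0, 1, 0)) (by simp [multiIdx])
  · exact nrm2_pdM_le h (β := (0, 0, 1)) (by simp [multiIdx])

lemma nrm2_pd_pd_le (l : ℝ) (h : SchwartzMap E3 ℝ) (i j : Fin 3) :
    nrm2 l (pd i (pd j h)) ≤ H2w l h := by
  wlog hij : i ≤ j generalizing i j
  · rw [pd_pd_comm]
    exact this j i (le_of_not_ge hij)
  fin_cases i <;> fin_cases j
  · exact nrm2_pdM_le h (β := (2, 0, 0)) (by simp [multiIdx])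
  · exact nrm2_pdM_le h (β := (1, 1, 0)) (by simp [multiIdx])
  · exact nrm2_pdM_le h (β := (1, 0, 1)) (by simp [multiIdx])
  · simp at hij
  · exact nrm2_pdM_le h (β := (0, 2, 0)) (by simp [multiIdx])
  · exact nrm2_pdM_le h (β := (0, 1, 1)) (by simp [multiIdx])
  · simp at hij
  · simp at hij
  · exact nrm2_pdM_le h (β := (0, 0, 2)) (by simp [multiIdx])

lemma pd_jbMul (l : ℝ) (w : SchwartzMap E3 ℝ) (k : Fin 3) (v : E3) :
    schwartzPd k (jbMul l w) v =
      jbMul l (schwartzPd k w) v + l * (v k * (1 + ‖v‖ ^ 2)⁻¹) * jbMul l w v := by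
  have hs : ‖v‖ ^ 2 + 1 ≠ 0 := by positivity
  have e : ⇑(jbMul l w) = fun v => (‖v‖ ^ 2 + 1) ^ (l / 2) * w v := by
    ext v
    rw [jbMul_apply, jb_rpow, add_comm]
  have h1 := (hasFDerivAt_normSq_add 1 v).rpow_const (p := l / 2) (Or.inl hs)
  rw [coe_schwartzPd, jbMul_apply, coe_schwartzPd, e, jb_rpow, add_comm (1 : ℝ)]
  unfold pd
  rw [(h1.fun_mul (w.hasFDerivAt v)).fderiv, Real.rpow_sub_one hs]
  simp [EuclideanSpace.inner_single_right]
  ring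

lemma integral_schwartzPd_jbMul_sq_le (l : ℝ) (w : SchwartzMap E3 ℝ) (k : Fin 3) :
    ∫ v, schwartzPd k (jbMul l w) v ^ 2 ≤
      2 * nrm2 l (schwartzPd k w) ^ 2 + 2 * l ^ 2 * nrm2 l w ^ 2 := by
  rw [nrm2_sq, nrm2_sq, ← integral_const_mul, ← integral_const_mul,
    ← integral_add ((integrable_schwartz_sq _).const_mul _)
      ((integrable_schwartz_sq _).const_mul _)]
  refine integral_mono (integrable_schwartz_sq _)
    (((integrable_schwartz_sq _).const_mul _).add ((integrable_schwartz_sq _).const_mul _))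
    fun v => ?_
  have hθ : (v k * (1 + ‖v‖ ^ 2)⁻¹) ^ 2 ≤ 1 := by
    rw [sq_le_one_iff_abs_le_one, ← div_eq_mul_inv, abs_div,
      abs_of_pos (by positivity : 0 < 1 + ‖v‖ ^ 2), div_le_one (by positivity)]
    refine (abs_apply_le_norm v k).trans ?_
    nlinarith [sq_nonneg (‖v‖ - 1)]
  simp only [pd_jbMul]
  generalize v k * (1 + ‖v‖ ^ 2)⁻¹ = θ at hθ
  generalize jbMul l (schwartzPd k w) v = x
  generalize jbMul l w v = y
  have h1 : (l * θ * y) ^ 2 ≤ l ^ 2 * y ^ 2 := by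
    calc (l * θ * y) ^ 2 = l ^ 2 * y ^ 2 * θ ^ 2 := by ring
      _ ≤ l ^ 2 * y ^ 2 * 1 := by gcongr
      _ = _ := mul_one _
  nlinarith [sq_nonneg (x - l * θ * y)]

/-! ### The trilinear estimates -/

/-- The constant in the trilinear estimates. -/
def landauConst : ℝ := Real.sqrt (32 ^ 2 * (∫ u, rho u) * 624)

lemma abs_le_landauConst_mul {x A B H : ℝ} (hA : 0 ≤ A) (hB : 0 ≤ B) (hH : 0 ≤ H)
    (h : x ^ 2 ≤ 32 ^ 2 * (∫ u, rho u) * A ^ 2 * B ^ 2 * (624 * H ^ 2)) :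
    |x| ≤ landauConst * A * B * H := by
  have hJ0 : 0 ≤ ∫ u, rho u := integral_nonneg rho_nonneg
  have hc : landauConst ^ 2 = 32 ^ 2 * (∫ u, rho u) * 624 := Real.sq_sqrt (by positivity)
  have hc0 : 0 ≤ landauConst := Real.sqrt_nonneg _
  refine abs_le_of_sq_le_sq (h.trans (le_of_eq ?_)) (by positivity)
  rw [mul_pow, mul_pow, mul_pow, hc]
  ring

lemma H2w_nonneg (l : ℝ) (h : E3 → ℝ) : 0 ≤ H2w l h :=
  Finset.sum_nonneg fun _ _ => nrm2_nonneg _ _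

lemma abs_integral_phiReg_le {γ : ℝ} (hγ : γ ∈ Set.Icc (-3 : ℝ) 1) (l : ℝ)
    (f g h : SchwartzMap E3 ℝ) (i j : Fin 3) :
    |∫ v, kconv (phiReg γ 0 i j) f v * schwartzPd j (schwartzPd i h) v * g v| ≤
      landauConst * nrm2 5 f * nrm2 (5 - l) g * H2w l h := by
  have hk := singularKernel_phiReg hγ le_rfl zero_le_one i j
  refine abs_le_landauConst_mul (nrm2_nonneg _ _) (nrm2_nonneg _ _) (H2w_nonneg _ _) ?_
  refine (sq_integral_kconv_mul_le (b := fun _ => 1) (l := l) measurable_const (fun u => ?_) f g _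
    (hk.polyGrowth f).diff.continuous.measurable.aemeasurable
    (sq_nonneg (nrm2 l (schwartzPd j (schwartzPd i h)))) fun c => ?_).trans ?_
  · simpa using abs_phiReg_le hγ le_rfl zero_le_one i j u
  · simp [lintegral_enorm_jbMul_sq]
  · have hJ0 : 0 ≤ ∫ u, rho u := integral_nonneg rho_nonneg
    have h1 := nrm2_pd_pd_le l h j i
    have h0 := nrm2_nonneg l (pd j (pd i h))
    rw [coe_schwartzPd, coe_schwartzPd]
    gcongr
    nlinarith

lemma abs_integral_divReg_le {γ : ℝ} (hγ : γ ∈ Set.Icc (-3 : ℝ) 1) {l : ℝ} (hl : l ^ 2 = 25)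
    (f g h : SchwartzMap E3 ℝ) (i : Fin 3) :
    |∫ v, kconv (divReg γ 0 i) f v * schwartzPd i h v * g v| ≤
      landauConst * nrm2 5 f * nrm2 (5 - l) g * H2w l h := by
  have hk := singularKernel_divReg hγ le_rfl zero_le_one i
  have hsum : 4 * ∑ k, ∫ v, schwartzPd k (jbMul l (schwartzPd i h)) v ^ 2 ≤ 624 * H2w l h ^ 2 := by
    have hk : ∀ k, ∫ v, schwartzPd k (jbMul l (schwartzPd i h)) v ^ 2 ≤ 52 * H2w l h ^ 2 := by
      intro k
      refine (integral_schwartzPd_jbMul_sq_le l _ k).trans ?_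
      rw [coe_schwartzPd, coe_schwartzPd, hl]
      have h1 := pow_le_pow_left₀ (nrm2_nonneg _ _) (nrm2_pd_pd_le l h k i) 2
      have h2 := pow_le_pow_left₀ (nrm2_nonneg _ _) (nrm2_pd_le l h i) 2
      linarith
    have := Finset.sum_le_sum fun k (_ : k ∈ Finset.univ) => hk k
    rw [Finset.sum_const, Finset.card_univ, Fintype.card_fin, nsmul_eq_mul] at this
    push_cast at this
    linarith
  refine abs_le_landauConst_mul (nrm2_nonneg _ _) (nrm2_nonneg _ _) (H2w_nonneg _ _) ?_
  refine (sq_integral_kconv_mul_le (b := fun u => ‖u‖⁻¹) (l := l)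
    (M := 4 * ∑ k, ∫ v, schwartzPd k (jbMul l (schwartzPd i h)) v ^ 2) (by fun_prop)
    (fun u => ?_) f g _ (hk.polyGrowth f).diff.continuous.measurable.aemeasurable
    (mul_nonneg (by norm_num) (Finset.sum_nonneg fun k _ => integral_nonneg fun v => sq_nonneg _))
    fun c => ?_).trans ?_
  · refine (abs_divReg_le hγ le_rfl zero_le_one i u).trans (le_of_eq ?_)
    rw [abs_of_nonneg (by positivity)]
    ring
  · refine le_trans (le_of_eq ?_) (hardy (jbMul l (schwartzPd i h)) c)
    congr 1
    ext v
    rw [← enorm_mul, real_enorm_sq, mul_pow, inv_pow, norm_sub_rev]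
  · have hJ0 : 0 ≤ ∫ u, rho u := integral_nonneg rho_nonneg
    gcongr

lemma abs_integral_landauQ_mul_le {γ : ℝ} (hγ : γ ∈ Set.Icc (-3 : ℝ) 1) {l : ℝ} (hl : l ^ 2 = 25)
    (f g h : SchwartzMap E3 ℝ) :
    |∫ v, landauQ γ f g v * h v| ≤
      15 * landauConst * nrm2 5 f * nrm2 (5 - l) g * H2w l h := by
  rw [integral_landauQ_mul hγ]
  set K := landauConst * nrm2 5 f * nrm2 (5 - l) g * H2w l h with hK
  have hi : ∀ i, |2 * (∫ v, kconv (divReg γ 0 i) f v * schwartzPd i h v * g v) +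
      ∑ j, ∫ v, kconv (phiReg γ 0 i j) f v * schwartzPd j (schwartzPd i h) v * g v| ≤ 5 * K := by
    intro i
    have h1 := abs_integral_divReg_le hγ hl f g h i
    have h2 : |∑ j, ∫ v, kconv (phiReg γ 0 i j) f v * schwartzPd j (schwartzPd i h) v * g v| ≤
        ∑ _j : Fin 3, K :=
      (Finset.abs_sum_le_sum_abs _ _).trans
        (Finset.sum_le_sum fun j _ => abs_integral_phiReg_le hγ l f g h i j)
    rw [Finset.sum_const, Finset.card_univ, Fintype.card_fin, nsmul_eq_mul] at h2
    push_cast at h2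
    refine (abs_add_le _ _).trans ?_
    rw [abs_mul, abs_two]
    linarith
  calc _ ≤ ∑ _i : Fin 3, 5 * K :=
        (Finset.abs_sum_le_sum_abs _ _).trans (Finset.sum_le_sum fun i _ => hi i)
    _ = _ := by
      rw [Finset.sum_const, Finset.card_univ, Fintype.card_fin, nsmul_eq_mul, hK]
      push_cast
      ring

/-- For `γ ∈ [-3,1]` there is `C > 0` depending only on `γ` such that for all
Schwartz functions `f, g, h`, the Landau collision operator satisfies
`|∫ Q(f,g) h| ≤ C ‖f‖_{L²_5} ‖g‖_{L²} ‖h‖_{H²_5}` and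
`|∫ Q(f,g) h| ≤ C ‖f‖_{L²_5} ‖g‖_{L²_{10}} ‖h‖_{H²_{-5}}`. -/
theorem landau_collision_upper_bounds (γ : ℝ) (hγ : γ ∈ Set.Icc (-3 : ℝ) 1) :
    ∃ C : ℝ, 0 < C ∧
      ∀ f g h : SchwartzMap (EuclideanSpace ℝ (Fin 3)) ℝ,
        |∫ v, landauQ γ (⇑f) (⇑g) v * h v| ≤ C * nrm2 5 f * nrm2 0 g * H2w 5 h ∧
        |∫ v, landauQ γ (⇑f) (⇑g) v * h v| ≤ C * nrm2 5 f * nrm2 10 g * H2w (-5) h := by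
  have hc : 0 ≤ landauConst := Real.sqrt_nonneg _
  have key : ∀ l : ℝ, l ^ 2 = 25 → ∀ f g h : SchwartzMap E3 ℝ,
      |∫ v, landauQ γ f g v * h v| ≤
        (15 * landauConst + 1) * nrm2 5 f * nrm2 (5 - l) g * H2w l h := by
    intro l hl f g h
    refine (abs_integral_landauQ_mul_le hγ hl f g h).trans ?_
    have hf := nrm2_nonneg 5 f
    have hg := nrm2_nonneg (5 - l) g
    have hh := H2w_nonneg l h
    gcongr
    linarith
  refine ⟨15 * landauConst + 1, by positivity, fun f g h => ⟨?_, ?_⟩⟩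
  · simpa using key 5 (by norm_num) f g h
  · have := key (-5) (by norm_num) f g h
    norm_num at this ⊢
    exact this
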